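/- (Deterministic core of the initial length scale estimate.) Let d, R, K ≥ 1 be integers, M > 0, β > 0, let L > R be an integer and x ∈ ℤᵈ. Let V : ℤᵈ → ℝ satisfy 0 ≤ V(n) ≤ M for all n and V(n) = 0 for n ∉ Λ_L(x), and suppose the spatial average W(n) := (4RK+1)^{−d} · ∑_{γ∈ℤᵈ, |γ|_∞ ≤ 2RK} V(n−γ) satisfies W(n) ≥ β for every n ∈ Λ_L(x). Then for every φ : ℤᵈ → ℂ supported in Λ_L(x) with ‖φ‖ = 1 and whose energy s := ½E(φ) + ∑_{n∈ℤᵈ} V(n)|φ(n)|² satisfies s ≤ 1, one has s ≥ ( β / (2(1 + 8dMRK)) )². -/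

import Mathlib

open scoped BigOperators Classical

noncomputable section

/-- The max-norm `|n|_∞` on `ℤᵈ` (as a natural number). -/
def maxNorm {d : ℕ} (n : Fin d → ℤ) : ℕ := Finset.univ.sup fun i => (n i).natAbs

/-- The `ℓ¹`-norm `|n|₁` on `ℤᵈ` (as a natural number). -/
def oneNorm {d : ℕ} (n : Fin d → ℤ) : ℕ := ∑ i, (n i).natAbs

/-- `D` is an `R`-Delone set in `ℤᵈ`: every cube `x + {0,…,R}ᵈ` contains a point of `D`. -/
def IsDeloneSet (d R : ℕ) (D : Set (Fin d → ℤ)) : Prop :=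
  ∀ x : Fin d → ℤ, ∃ γ ∈ D, ∀ i, x i ≤ γ i ∧ γ i ≤ x i + (R : ℤ)

/-- The cube `Λ_L(x)` of side length `2L+1` centered at `x`. -/
def cube (d : ℕ) (L : ℕ) (x : Fin d → ℤ) : Set (Fin d → ℤ) :=
  {n | maxNorm (n - x) ≤ L}

/-- The squared `ℓ²`-norm `‖φ‖² = ∑_n |φ(n)|²`. -/
def normSq {d : ℕ} (φ : (Fin d → ℤ) → ℂ) : ℝ := ∑' n, ‖φ n‖ ^ 2

/-- The Dirichlet energy `E(φ) = ∑_n ∑_{|m−n|₁=1} |φ(m)−φ(n)|²`. -/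
def energy {d : ℕ} (φ : (Fin d → ℤ) → ℂ) : ℝ :=
  ∑' n, ∑' m, if oneNorm (m - n) = 1 then ‖φ m - φ n‖ ^ 2 else 0

def shiftDiff {d : ℕ} (f : (Fin d → ℤ) → ℝ) (g : Fin d → ℤ) : ℝ := ∑' n, |f (n + g) - f n|

lemma summable_shift {d : ℕ} {f : (Fin d → ℤ) → ℝ} (hf : Summable f) (g : Fin d → ℤ) :
    Summable fun n => f (n + g) :=
  hf.comp_injective (add_left_injective g)

lemma tsum_shift {d : ℕ} (f : (Fin d → ℤ) → ℝ) (g : Fin d → ℤ) :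
    ∑' n, f (n + g) = ∑' n, f n :=
  (Equiv.addRight g).tsum_eq f

lemma shiftDiff_summable {d : ℕ} {f : (Fin d → ℤ) → ℝ} (hf : Summable f) (g : Fin d → ℤ) :
    Summable fun n => |f (n + g) - f n| :=
  ((summable_shift hf g).sub hf).abs

lemma shiftDiff_zero {d : ℕ} (f : (Fin d → ℤ) → ℝ) : shiftDiff f 0 = 0 := by
  simp [shiftDiff]

lemma shiftDiff_nonneg {d : ℕ} (f : (Fin d → ℤ) → ℝ) (g) : 0 ≤ shiftDiff f g :=
  tsum_nonneg fun _ => abs_nonneg _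

lemma shiftDiff_add {d : ℕ} {f : (Fin d → ℤ) → ℝ} (hf : Summable f) (g h : Fin d → ℤ) :
    shiftDiff f (g + h) ≤ shiftDiff f g + shiftDiff f h := by
  have h1 := tsum_shift (fun n => |f (n + g) - f n|) h
  have s1 := summable_shift (shiftDiff_summable hf g) h
  have s2 := shiftDiff_summable hf h
  unfold shiftDiff
  rw [← h1, ← s1.tsum_add s2]
  refine (shiftDiff_summable hf _).tsum_le_tsum (fun n => ?_) (s1.add s2)
  have e : n + (g + h) = n + h + g := by abel
  rw [e]
  exact abs_sub_le _ _ _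

lemma shiftDiff_neg {d : ℕ} (f : (Fin d → ℤ) → ℝ) (g : Fin d → ℤ) :
    shiftDiff f (-g) = shiftDiff f g := by
  have h1 := tsum_shift (fun n => |f (n + g) - f n|) (-g)
  unfold shiftDiff
  rw [← h1]
  refine tsum_congr fun n => ?_
  simp [abs_sub_comm]

lemma shiftDiff_nsmul {d : ℕ} {f : (Fin d → ℤ) → ℝ} (hf : Summable f) (g : Fin d → ℤ) (k : ℕ) :
    shiftDiff f (k • g) ≤ k * shiftDiff f g := by
  induction k with
  | zero => simp [shiftDiff_zero]
  | succ k ih =>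
    rw [succ_nsmul]
    have := shiftDiff_add hf (k • g) g
    push_cast
    linarith

lemma shiftDiff_zsmul {d : ℕ} {f : (Fin d → ℤ) → ℝ} (hf : Summable f) (g : Fin d → ℤ) (k : ℤ) :
    shiftDiff f (k • g) ≤ k.natAbs * shiftDiff f g := by
  rcases Int.natAbs_eq k with h | h
  · have := shiftDiff_nsmul hf g k.natAbs
    rw [← natCast_zsmul, ← h] at this
    exact this
  · have := shiftDiff_nsmul hf g k.natAbs
    rw [← natCast_zsmul, ← shiftDiff_neg, ← neg_zsmul, ← h] at this
    exact this

lemma shiftDiff_le {d : ℕ} {f : (Fin d → ℤ) → ℝ} (hf : Summable f) (g : Fin d → ℤ) (N : ℕ)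
    (hg : maxNorm g ≤ N) (c : ℝ) (hc : ∀ i, shiftDiff f (Pi.single i 1) ≤ c) :
    shiftDiff f g ≤ d * (N * c) := by
  have e : g = ∑ i, g i • (Pi.single i 1 : Fin d → ℤ) := by
    ext j
    simp [Finset.sum_apply, Pi.single_apply]
  have h1 := Finset.le_sum_of_subadditive (shiftDiff f) (shiftDiff_zero f).le
    (shiftDiff_add hf) Finset.univ (fun i => g i • (Pi.single i 1 : Fin d → ℤ))
  rw [← e] at h1
  refine h1.trans ?_
  have : ∀ i ∈ (Finset.univ : Finset (Fin d)),
      shiftDiff f (g i • (Pi.single i 1 : Fin d → ℤ)) ≤ N * c := fun i _ => by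
    refine (shiftDiff_zsmul hf _ _).trans ?_
    have hi : (g i).natAbs ≤ N :=
      (Finset.le_sup (f := fun i => (g i).natAbs) (Finset.mem_univ i)).trans hg
    have h0 := shiftDiff_nonneg f (Pi.single i 1)
    have hi' : ((g i).natAbs : ℝ) ≤ N := by exact_mod_cast hi
    exact mul_le_mul hi' (hc i) h0 (by positivity)
  refine (Finset.sum_le_card_nsmul _ _ _ this).trans ?_
  simp

def box (d N : ℕ) : Finset (Fin d → ℤ) := Finset.Icc (fun _ => -(N : ℤ)) (fun _ => (N : ℤ))

lemma mem_box {d N : ℕ} (g : Fin d → ℤ) : g ∈ box d N ↔ maxNorm g ≤ N := by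
  simp only [box, Finset.mem_Icc, Pi.le_def, maxNorm, Finset.sup_le_iff, Finset.mem_univ,
    true_imp_iff]
  constructor
  · rintro ⟨h1, h2⟩ i
    have := h1 i
    have := h2 i
    omega
  · intro h
    constructor <;> intro i <;> have := h i <;> omega

lemma card_box (d N : ℕ) : (box d N).card = (2 * N + 1) ^ d := by
  simp only [box, Pi.card_Icc, Int.card_Icc, Finset.prod_const, Finset.card_univ, Fintype.card_fin]
  congr 1
  omega

lemma cube_finite (d L : ℕ) (x : Fin d → ℤ) : (cube d L x).Finite := by
  refine ((box d L).finite_toSet.preimage (f := fun n => n - x) ?_).subset ?_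
  · exact (sub_left_injective).injOn
  · intro n hn
    simpa [mem_box, cube] using hn

lemma nbr_finite (d : ℕ) (n : Fin d → ℤ) : {m | oneNorm (m - n) = 1}.Finite := by
  refine (cube_finite d 1 n).subset ?_
  intro m hm
  have hm' : oneNorm (m - n) = 1 := hm
  show maxNorm (m - n) ≤ 1
  rw [← hm']
  refine Finset.sup_le fun i hi => ?_
  exact Finset.single_le_sum (f := fun i => ((m - n) i).natAbs) (fun _ _ => Nat.zero_le _) hi

lemma oneNorm_neg {d : ℕ} (n : Fin d → ℤ) : oneNorm (-n) = oneNorm n := by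
  simp [oneNorm]

lemma oneNorm_single {d : ℕ} (i : Fin d) : oneNorm (Pi.single i 1 : Fin d → ℤ) = 1 := by
  unfold oneNorm
  rw [Finset.sum_eq_single i]
  · simp
  · intro j _ hj
    simp [Pi.single_apply, hj]
  · simp

lemma energy_ge {d : ℕ} (φ : (Fin d → ℤ) → ℂ) (hφ : (Function.support φ).Finite) (i : Fin d) :
    (∑' n, ‖φ (n + Pi.single i 1) - φ n‖ ^ 2) ≤ (1 / 2) * energy φ ∧
    Summable (fun n => ‖φ (n + Pi.single i 1) - φ n‖ ^ 2) := by
  set e : Fin d → ℤ := Pi.single i 1 with he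
  have he1 : oneNorm e = 1 := oneNorm_single i
  have hene : e ≠ -e := by
    intro h
    have := congrFun h i
    simp [he] at this
  have hS : Summable (fun n => ‖φ (n + e) - φ n‖ ^ 2) := by
    apply summable_of_hasFiniteSupport
    refine (hφ.union (hφ.preimage (f := fun n => n + e) (add_left_injective e).injOn)).subset ?_
    intro n hn
    by_contra h
    simp only [Set.mem_union, Function.mem_support, Set.mem_preimage, not_or, not_not] at h
    apply hn
    simp [h.1, h.2]
  refine ⟨?_, hS⟩
  set F : (Fin d → ℤ) → (Fin d → ℤ) → ℝ :=
    fun n m => if oneNorm (m - n) = 1 then ‖φ m - φ n‖ ^ 2 else 0 with hF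
  have hF0 : ∀ n m, 0 ≤ F n m := fun n m => by
    simp only [hF]; split_ifs <;> positivity
  have hin : ∀ n, Summable (F n) := fun n => by
    apply summable_of_hasFiniteSupport
    refine (nbr_finite d n).subset fun m hm => ?_
    by_contra h
    apply hm
    simp only [hF]
    exact if_neg h
  have hout : Summable fun n => ∑' m, F n m := by
    apply summable_of_hasFiniteSupport
    refine (hφ.union (hφ.biUnion (t := fun m => {n | oneNorm (n - m) = 1})
      fun m _ => nbr_finite d m)).subset fun n hn => ?_
    by_contra h
    simp only [Set.mem_union, Function.mem_support, Set.mem_iUnion, not_or, not_not, not_exists,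
      Set.mem_setOf_eq] at h
    apply hn
    have : ∀ m, F n m = 0 := fun m => by
      simp only [hF]
      split_ifs with h1
      · by_cases hm : φ m = 0
        · simp [hm, h.1]
        · exfalso
          refine h.2 m hm ?_
          rw [← oneNorm_neg, neg_sub]; exact h1
      · rfl
    simp [this]
  have hlow : ∀ n, ‖φ (n + e) - φ n‖ ^ 2 + ‖φ (n + -e + e) - φ (n + -e)‖ ^ 2 ≤ ∑' m, F n m := by
    intro n
    have h := (hin n).sum_le_tsum {n + e, n + -e} (fun m _ => hF0 n m)
    rw [Finset.sum_pair (by simpa using hene)] at h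
    refine le_trans (le_of_eq ?_) h
    simp only [hF]
    rw [if_pos (by simpa using he1), if_pos (by simpa [oneNorm_neg] using he1)]
    simp [norm_sub_rev]
  have hS2 := summable_shift hS (-e)
  have h1 := (hS.add hS2).tsum_le_tsum hlow hout
  rw [hS.tsum_add hS2, tsum_shift (fun n => ‖φ (n + e) - φ n‖ ^ 2) (-e)] at h1
  have h2 : energy φ = ∑' n, ∑' m, F n m := rfl
  rw [h2]
  linarith

theorem statement5 (d R K : ℕ) (hd : 1 ≤ d) (hR : 1 ≤ R) (hK : 1 ≤ K)
    (M β : ℝ) (hM : 0 < M) (hβ : 0 < β) (L : ℕ) (hL : R < L) (x : Fin d → ℤ)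
    (V : (Fin d → ℤ) → ℝ) (hV : ∀ n, 0 ≤ V n ∧ V n ≤ M)
    (hVsupp : ∀ n, n ∉ cube d L x → V n = 0)
    (hW : ∀ n ∈ cube d L x,
      ((4 * (R : ℝ) * (K : ℝ) + 1) ^ d)⁻¹ *
          ∑' γ : Fin d → ℤ, (if maxNorm γ ≤ 2 * R * K then V (n - γ) else 0) ≥ β)
    (φ : (Fin d → ℤ) → ℂ) (hφ : Function.support φ ⊆ cube d L x)
    (hnorm : normSq φ = 1)
    (hs : (1 / 2) * energy φ + (∑' n, V n * ‖φ n‖ ^ 2) ≤ 1) :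
    (1 / 2) * energy φ + (∑' n, V n * ‖φ n‖ ^ 2) ≥
      (β / (2 * (1 + 8 * (d : ℝ) * M * (R : ℝ) * (K : ℝ)))) ^ 2 := by
  have hfin : (Function.support φ).Finite := (cube_finite d L x).subset hφ
  by_contra hcon
  push Not at hcon
  set s := (1 / 2) * energy φ + (∑' n, V n * ‖φ n‖ ^ 2) with hsdef
  set C := 1 + 8 * (d : ℝ) * M * (R : ℝ) * (K : ℝ) with hC
  have hC1 : 1 ≤ C := by
    have : 0 ≤ 8 * (d : ℝ) * M * (R : ℝ) * (K : ℝ) := by positivity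
    linarith
  set q := β / (2 * C) with hq
  have hq0 : 0 < q := by positivity
  have hqC : C * q = β / 2 := by rw [hq]; field_simp
  set f : (Fin d → ℤ) → ℝ := fun n => ‖φ n‖ ^ 2 with hf
  have hfs : Summable f := by
    apply summable_of_hasFiniteSupport
    refine hfin.subset fun n hn => ?_
    intro h
    apply hn
    simp [hf, h]
  have hf0 : ∀ n, 0 ≤ f n := fun n => by simp only [hf]; positivity
  have hf1 : ∑' n, f n = 1 := hnorm
  have hP0 : 0 ≤ ∑' n, V n * f n := tsum_nonneg fun n => mul_nonneg (hV n).1 (hf0 n)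
  have hVs : ∀ U : (Fin d → ℤ) → ℝ, (∀ n, 0 ≤ U n ∧ U n ≤ M) → ∀ h : (Fin d → ℤ) → ℝ,
      (∀ n, 0 ≤ h n) → Summable h → Summable fun n => U n * h n := fun U hU h h0 hh =>
    Summable.of_nonneg_of_le (fun n => mul_nonneg (hU n).1 (h0 n))
      (fun n => mul_le_mul_of_nonneg_right (hU n).2 (h0 n)) (hh.mul_left M)
  have hE0 : 0 ≤ energy φ := by
    unfold energy
    exact tsum_nonneg fun n => tsum_nonneg fun m => by split_ifs <;> positivity
  have hPs : (∑' n, V n * f n) ≤ s := by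
    have : s = (1 / 2) * energy φ + (∑' n, V n * f n) := rfl
    linarith
  have hEs : (1 / 2) * energy φ ≤ s := by
    have : s = (1 / 2) * energy φ + (∑' n, V n * f n) := rfl
    linarith
  have hG : ∀ i, shiftDiff f (Pi.single i 1) ≤ 2 * q := by
    intro i
    obtain ⟨hA, hAs⟩ := energy_ge φ hfin i
    set e : Fin d → ℤ := Pi.single i 1
    have hfe := summable_shift hfs e
    have hpt : ∀ n, |f (n + e) - f n| ≤
        q⁻¹ * ‖φ (n + e) - φ n‖ ^ 2 + (q / 2) * (f (n + e) + f n) := by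
      intro n
      simp only [hf]
      set a := ‖φ (n + e)‖
      set b := ‖φ n‖
      set D := ‖φ (n + e) - φ n‖
      have ha : 0 ≤ a := norm_nonneg _
      have hb : 0 ≤ b := norm_nonneg _
      have hab : |a - b| ≤ D := abs_norm_sub_norm_le _ _
      have h1 : |a ^ 2 - b ^ 2| ≤ D * (a + b) := by
        rw [sq_sub_sq, abs_mul, abs_of_nonneg (add_nonneg ha hb), mul_comm]
        exact mul_le_mul_of_nonneg_right hab (add_nonneg ha hb)
      refine h1.trans ?_
      have h2 : q⁻¹ * D ^ 2 + q / 2 * (a ^ 2 + b ^ 2) - D * (a + b) =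
          q⁻¹ * ((D - q * (a + b) / 2) ^ 2 + (q * (a - b) / 2) ^ 2) := by
        field_simp
        ring
      have h3 : 0 ≤ q⁻¹ * ((D - q * (a + b) / 2) ^ 2 + (q * (a - b) / 2) ^ 2) := by positivity
      linarith
    have h4 := (shiftDiff_summable hfs e).tsum_le_tsum hpt
      ((hAs.mul_left _).add ((hfe.add hfs).mul_left _))
    rw [(hAs.mul_left _).tsum_add ((hfe.add hfs).mul_left _), tsum_mul_left, tsum_mul_left,
      hfe.tsum_add hfs, tsum_shift f e, hf1] at h4
    have h5 : q⁻¹ * (∑' n, ‖φ (n + e) - φ n‖ ^ 2) ≤ q := by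
      rw [inv_mul_le_iff₀ hq0]
      nlinarith
    unfold shiftDiff
    linarith
  -- main averaging
  set N := 2 * R * K with hN
  set c : ℝ := s + M * (d * (N * (2 * q))) with hc
  have hγ : ∀ γ ∈ box d N, (∑' n, V (n - γ) * f n) ≤ c := by
    intro γ hγ
    rw [mem_box] at hγ
    have h1 : (∑' n, V (n - γ) * f n) = ∑' n, V n * f (n + γ) := by
      rw [← tsum_shift (fun n => V (n - γ) * f n) γ]
      simp
    rw [h1]
    have hab := shiftDiff_summable hfs γ
    have h2 : (∑' n, V n * f (n + γ)) ≤ ∑' n, (V n * f n + M * |f (n + γ) - f n|) := by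
      refine (hVs V hV _ (fun n => hf0 _) (summable_shift hfs γ)).tsum_le_tsum (fun n => ?_)
        ((hVs V hV f hf0 hfs).add (hab.mul_left M))
      have h3 : V n * (f (n + γ) - f n) ≤ M * |f (n + γ) - f n| :=
        (mul_le_mul_of_nonneg_left (le_abs_self _) (hV n).1).trans
          (mul_le_mul_of_nonneg_right (hV n).2 (abs_nonneg _))
      linarith
    rw [(hVs V hV f hf0 hfs).tsum_add (hab.mul_left M), tsum_mul_left] at h2
    have h4 := mul_le_mul_of_nonneg_left (shiftDiff_le hfs γ N hγ (2 * q) hG) hM.le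
    unfold shiftDiff at h4
    linarith
  have hsm : ∀ γ ∈ box d N, Summable fun n => V (n - γ) * f n := fun γ _ =>
    hVs (fun n => V (n - γ)) (fun n => hV _) f hf0 hfs
  have hcard : ((box d N).card : ℝ) = (4 * (R : ℝ) * (K : ℝ) + 1) ^ d := by
    rw [card_box, hN]
    push_cast
    ring
  have hcpos : (0 : ℝ) < (box d N).card := by rw [hcard]; positivity
  have hpt : ∀ n, (box d N).card * β * f n ≤ ∑ γ ∈ box d N, V (n - γ) * f n := by
    intro n
    rw [← Finset.sum_mul]
    by_cases hn : n ∈ cube d L x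
    · refine mul_le_mul_of_nonneg_right ?_ (hf0 n)
      have h1 := hW n hn
      rw [← hcard, ge_iff_le, le_inv_mul_iff₀ hcpos,
        tsum_eq_sum (s := box d N) (fun γ hγ => if_neg (by rwa [mem_box] at hγ))] at h1
      refine h1.trans (le_of_eq (Finset.sum_congr rfl fun γ hγ => ?_))
      exact if_pos ((mem_box γ).1 hγ)
    · have : φ n = 0 := by
        by_contra h
        exact hn (hφ h)
      simp [hf, this]
  have hsum := (hfs.mul_left _).tsum_le_tsum hpt (summable_sum hsm)
  rw [tsum_mul_left, hf1, Summable.tsum_finsetSum hsm] at hsum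
  have hfinal := hsum.trans (Finset.sum_le_card_nsmul _ _ _ hγ)
  rw [nsmul_eq_mul, mul_one] at hfinal
  have hβc : β ≤ c := le_of_mul_le_mul_left hfinal hcpos
  have hsq : s ≤ q := by
    by_contra h
    push Not at h
    nlinarith
  have hNc : (N : ℝ) = 2 * R * K := by rw [hN]; push_cast; ring
  have hpos : 0 ≤ (d : ℝ) * M * R * K * q := by positivity
  have h6 : c = s + 4 * (d * M * R * K * q) := by rw [hc, hNc]; ring
  have h7 : C * q = q + 8 * (d * M * R * K * q) := by rw [hC]; ring
  linarith
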